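/- Let A = kQ/I be a (locally) gentle algebra. Then the left and right graded global dimensions of A are equal, and gldim(A) = max over arrows α ∈ Q1 of the length of the maximal path γ#_α of the Koszul dual A# containing α; that is, gldim(A) equals the length of the longest maximal path in A#, where an infinite maximal path counts as length ∞. -/

import Mathlib

/- Common framework for (locally) gentle algebras -/

noncomputable section
open scoped BigOperators
open CategoryTheory

namespace LocGentle

/-- A finite connected quiver with at least one vertex and one arrow. -/
structure Quiv where
  V : Type
  Arr : Type
  [fintypeV : Fintype V]
  [fintypeA : Fintype Arr]
  [decEqV : DecidableEq V]
  [decEqA : DecidableEq Arr]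
  src : Arr → V
  tgt : Arr → V
  [nonemptyV : Nonempty V]
  [nonemptyA : Nonempty Arr]
  connected : (SimpleGraph.fromRel (fun v w => ∃ a, src a = v ∧ tgt a = w)).Connected

attribute [instance] Quiv.fintypeV Quiv.fintypeA Quiv.decEqV Quiv.decEqA
  Quiv.nonemptyV Quiv.nonemptyA

variable (Q : Quiv)

/-- in-degree of a vertex -/
def indeg (v : Q.V) : ℕ := (Finset.univ.filter (fun a => Q.tgt a = v)).card

/-- out-degree of a vertex -/
def outdeg (v : Q.V) : ℕ := (Finset.univ.filter (fun a => Q.src a = v)).card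

/-- a list of arrows is composable (forms a path) -/
def Composable (l : List Q.Arr) : Prop := l.Chain' (fun a b => Q.tgt a = Q.src b)

variable {Q}

/-- source vertex of a nonempty word -/
def wSrc? (l : List Q.Arr) : Option Q.V := l.head?.map Q.src

/-- target vertex of a nonempty word -/
def wTgt? (l : List Q.Arr) : Option Q.V := l.getLast?.map Q.tgt

/-- target of a word, with a default value (used for stationary paths) -/
def wTgtD (l : List Q.Arr) (v : Q.V) : Q.V := (l.getLast?.map Q.tgt).getD v

/-- last arrow of a word, with a (junk) default -/
def wLast (l : List Q.Arr) : Q.Arr := l.getLast?.getD (Classical.arbitrary _)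

variable (rel : Q.Arr → Q.Arr → Prop)

/-- A word is allowed (is a basis path of `A = kQ/I`) if consecutive arrows are
composable and no consecutive pair lies in the relation set generating `I`. -/
def AllowedWord (l : List Q.Arr) : Prop :=
  l.Chain' (fun a b => Q.tgt a = Q.src b ∧ ¬ rel a b)

/-- right maximal paths (of positive length) -/
def RightMaxWord (l : List Q.Arr) : Prop :=
  l ≠ [] ∧ AllowedWord rel l ∧ ∀ a : Q.Arr, ¬ AllowedWord rel (l ++ [a])

/-- left maximal paths (of positive length) -/
def LeftMaxWord (l : List Q.Arr) : Prop :=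
  l ≠ [] ∧ AllowedWord rel l ∧ ∀ a : Q.Arr, ¬ AllowedWord rel (a :: l)

/-- finite maximal paths -/
def FiniteMaxWord (l : List Q.Arr) : Prop := RightMaxWord rel l ∧ LeftMaxWord rel l

/-- a word is primitive if it is not a proper power -/
def PrimitiveWord (l : List Q.Arr) : Prop :=
  ∀ (l' : List Q.Arr) (n : ℕ), 2 ≤ n → l ≠ (List.replicate n l').flatten

/-- a primitive cycle `c` with `c² ∉ I`; these represent the infinite maximal paths `c^∞`. -/
def PrimCycleSq (c : List Q.Arr) : Prop :=
  c ≠ [] ∧ AllowedWord rel (c ++ c) ∧ wTgt? c = wSrc? c ∧ PrimitiveWord c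

/-- the maximal path `γ_α` containing `α` is infinite -/
def InfThrough (a : Q.Arr) : Prop := ∃ c, PrimCycleSq rel c ∧ a ∈ c

/-- the maximal path `γ_α` containing `α` is finite -/
def FinThrough (a : Q.Arr) : Prop := ∃ l, FiniteMaxWord rel l ∧ a ∈ l

/-- the rotation of the cycle `c` starting at the arrow `a`; when `a ∈ c` and `c` has no
duplicates this is the primitive cycle `γ_r(a)`. -/
def rotTo (c : List Q.Arr) (a : Q.Arr) : List Q.Arr :=
  c.dropWhile (fun b => b != a) ++ c.takeWhile (fun b => b != a)

/-- the relation set of the Koszul dual `A#`; its allowed words are the forbidden paths of `A`. -/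
def dualRel : Q.Arr → Q.Arr → Prop := fun a b => Q.tgt a = Q.src b ∧ ¬ rel a b

/-- a forbidden path of `A`, i.e. a path of the Koszul dual `A#` -/
def ForbiddenWord (l : List Q.Arr) : Prop := AllowedWord (dualRel rel) l

variable (Q)

/-- The defining conditions (i)-(iv) of a (locally) gentle algebra, in terms of the set of
length-two relations generating the ideal `I`: an algebra satisfying them is gentle if it
is finite dimensional and locally gentle otherwise. -/
structure IsGentleRel : Prop where
  indeg_le : ∀ v : Q.V, indeg Q v ≤ 2
  outdeg_le : ∀ v : Q.V, outdeg Q v ≤ 2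
  rel_comp : ∀ a b : Q.Arr, rel a b → Q.tgt a = Q.src b
  cond_ii : ∀ a b b' : Q.Arr, b ≠ b' → Q.tgt b = Q.src a → Q.tgt b' = Q.src a →
    Xor' (rel b a) (rel b' a)
  cond_iii : ∀ a b b' : Q.Arr, b ≠ b' → Q.tgt a = Q.src b → Q.tgt a = Q.src b' →
    Xor' (rel a b) (rel a b')

/-- `Q` is (as a quiver) the extended Dynkin quiver `Ã_n` (for `n = |Q₀| - 1`):
every vertex has in-degree and out-degree one. -/
def IsAtilde : Prop := ∀ v : Q.V, indeg Q v = 1 ∧ outdeg Q v = 1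

/-- paths of `Q`, including the stationary paths (`w = []`) at each vertex -/
structure Pth where
  s : Q.V
  w : List Q.Arr
  hs : ∀ a ∈ w.head?, Q.src a = s
  hc : Composable Q w

variable {Q}

/-- target of a path -/
def Pth.t (p : Pth Q) : Q.V := wTgtD p.w p.s

/-- length of a path -/
def Pth.len (p : Pth Q) : ℕ := p.w.length

/-- a basis path of `A = kQ/I` -/
def Pth.Allowed (p : Pth Q) : Prop := AllowedWord rel p.w

end LocGentle
namespace LocGentle

variable (k : Type) [Field k] (Q : Quiv) (rel : Q.Arr → Q.Arr → Prop)

/-- The defining relations presenting `A = kQ/I` as a quotient of the free algebra on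
the stationary paths (vertices) and arrows: the path algebra relations together with
the relations `αβ = 0` for the length-two paths `αβ` generating `I`. -/
inductive GARel : FreeAlgebra k (Q.V ⊕ Q.Arr) → FreeAlgebra k (Q.V ⊕ Q.Arr) → Prop
  | idem (v : Q.V) : GARel (FreeAlgebra.ι k (Sum.inl v) * FreeAlgebra.ι k (Sum.inl v))
      (FreeAlgebra.ι k (Sum.inl v))
  | orth (v w : Q.V) : v ≠ w → GARel (FreeAlgebra.ι k (Sum.inl v) * FreeAlgebra.ι k (Sum.inl w)) 0
  | unit : GARel (∑ v : Q.V, FreeAlgebra.ι k (Sum.inl v)) 1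
  | src_mul (a : Q.Arr) : GARel (FreeAlgebra.ι k (Sum.inl (Q.src a)) * FreeAlgebra.ι k (Sum.inr a))
      (FreeAlgebra.ι k (Sum.inr a))
  | mul_tgt (a : Q.Arr) : GARel (FreeAlgebra.ι k (Sum.inr a) * FreeAlgebra.ι k (Sum.inl (Q.tgt a)))
      (FreeAlgebra.ι k (Sum.inr a))
  | src_zero (v : Q.V) (a : Q.Arr) : v ≠ Q.src a →
      GARel (FreeAlgebra.ι k (Sum.inl v) * FreeAlgebra.ι k (Sum.inr a)) 0
  | tgt_zero (v : Q.V) (a : Q.Arr) : v ≠ Q.tgt a →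
      GARel (FreeAlgebra.ι k (Sum.inr a) * FreeAlgebra.ι k (Sum.inl v)) 0
  | rel_zero (a b : Q.Arr) : rel a b →
      GARel (FreeAlgebra.ι k (Sum.inr a) * FreeAlgebra.ι k (Sum.inr b)) 0

/-- The (locally) gentle algebra `A = kQ/I`. -/
abbrev GA := RingQuot (GARel k Q rel)

/-- the image in `A` of the stationary path at `v` -/
def vtx (v : Q.V) : GA k Q rel := RingQuot.mkAlgHom k _ (FreeAlgebra.ι k (Sum.inl v))

/-- the image in `A` of the arrow `a` -/
def arr (a : Q.Arr) : GA k Q rel := RingQuot.mkAlgHom k _ (FreeAlgebra.ι k (Sum.inr a))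

/-- the image in `A` of the word `l` (the product of its arrows) -/
def wordEl (l : List Q.Arr) : GA k Q rel := (l.map (arr k Q rel)).prod

variable {Q}

/-- the image in `A` of a path (a stationary path maps to the corresponding idempotent) -/
def Pth.el (p : Pth Q) : GA k Q rel := vtx k Q rel p.s * wordEl k Q rel p.w

variable (Q)

/-- the `n`-th graded component `A_n` of `A`, spanned by the images of paths of length `n` -/
def deg (n : ℕ) : Submodule k (GA k Q rel) :=
  Submodule.span k {x | ∃ p : Pth Q, p.Allowed rel ∧ p.len = n ∧ x = p.el k rel}

/-- the augmentation ideal `A₊` (as a `k`-submodule), spanned by paths of positive length -/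
def degPlus : Submodule k (GA k Q rel) :=
  Submodule.span k {x | ∃ p : Pth Q, p.Allowed rel ∧ 1 ≤ p.len ∧ x = p.el k rel}

/-- the Hilbert series of `A` (with integer coefficients) -/
def hilb : PowerSeries ℤ :=
  PowerSeries.mk fun n => (Module.finrank k (deg k Q rel n) : ℤ)

/-- the Hilbert series of `A` (with rational coefficients) -/
def hilbQ : PowerSeries ℚ :=
  PowerSeries.mk fun n => (Module.finrank k (deg k Q rel n) : ℚ)

/-- the number `k_n` of finite maximal paths of length at least `n` -/
def numFMP (n : ℕ) : ℕ := {l : List Q.Arr | FiniteMaxWord rel l ∧ n ≤ l.length}.ncard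

/-- the Gelfand-Kirillov dimension of `A`:
`limsup_n log (dim_k A_{≤ n}) / log n`. -/
def GKdim : ℝ :=
  Filter.limsup (fun n : ℕ =>
      Real.log (Module.finrank k ↥(⨆ i ∈ Finset.range (n + 1), deg k Q rel i)) / Real.log n)
    Filter.atTop

/-- the central element `m_γ` attached to the infinite maximal path `γ = c^∞`:
the sum over the arrows `α` of `c` of the primitive cycle `γ_r(α)` starting at `α`. -/
def mEl (c : List Q.Arr) : GA k Q rel := (c.map fun a => wordEl k Q rel (rotTo c a)).sum

/-- evaluation of a polynomial at `x ∈ A`; `polyEval k Q rel p x` is `p(x)`. -/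
def polyEval (p : Polynomial k) (x : GA k Q rel) : GA k Q rel :=
  Polynomial.eval₂ (algebraMap k (GA k Q rel)) x p

end LocGentle
namespace LocGentle

variable (k : Type) [Field k] (Q : Quiv) (rel : Q.Arr → Q.Arr → Prop)

/-! ### Two-sided ideals and primes -/

/-- a prime (two-sided) ideal -/
def IsPrimeTI (P : TwoSidedIdeal (GA k Q rel)) : Prop :=
  P ≠ ⊤ ∧ ∀ x y : GA k Q rel, (∀ a : GA k Q rel, x * a * y ∈ P) → x ∈ P ∨ y ∈ P

/-- the maximal ideal `𝔪_v` of `A` which does not contain `ε_v`: it is generated by the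
stationary paths at the other vertices together with all loops at `v`. -/
def mIdeal (v : Q.V) : TwoSidedIdeal (GA k Q rel) :=
  TwoSidedIdeal.span
    ({x | ∃ w : Q.V, w ≠ v ∧ x = vtx k Q rel w} ∪
     {x | ∃ a : Q.Arr, Q.src a = v ∧ Q.tgt a = v ∧ x = arr k Q rel a})

/-- the ideal `J_γ` corresponding to the infinite maximal path `γ = c^∞`, generated by
all arrows lying on `γ` -/
def Jgamma (c : List Q.Arr) : TwoSidedIdeal (GA k Q rel) :=
  TwoSidedIdeal.span {x | ∃ a ∈ c, x = arr k Q rel a}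

/-- the left annihilator of `J_γ` -/
def annJ (c : List Q.Arr) : Set (GA k Q rel) :=
  {x | ∀ y ∈ Jgamma k Q rel c, x * y = 0}

/-! ### The simple modules `S(v)`, and `Ext` groups -/

/-- the algebra map `A → k` corresponding to the vertex `v` (projection onto the
coefficient of `ε_v`) -/
def vtxHomAux (v : Q.V) : FreeAlgebra k (Q.V ⊕ Q.Arr) →ₐ[k] k :=
  FreeAlgebra.lift k (Sum.elim (fun w => if w = v then (1 : k) else 0) (fun _ => 0))

theorem vtxHomAux_rel (v : Q.V) : ∀ ⦃x y⦄, GARel k Q rel x y →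
    vtxHomAux k Q v x = vtxHomAux k Q v y := by
  intro x y h
  cases h with
  | idem w =>
      simp only [vtxHomAux, map_mul, FreeAlgebra.lift_ι_apply, Sum.elim_inl]
      split_ifs <;> simp
  | orth w w' hne =>
      simp only [vtxHomAux, map_mul, FreeAlgebra.lift_ι_apply, Sum.elim_inl, map_zero]
      split_ifs with h1 h2 <;> first | (exact absurd (h1.trans h2.symm) hne) | simp
  | unit =>
      simp only [vtxHomAux, map_sum, FreeAlgebra.lift_ι_apply, Sum.elim_inl, map_one]
      simp [Finset.sum_ite_eq' Finset.univ v (fun _ => (1:k))]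
  | src_mul a =>
      simp [vtxHomAux, map_mul, FreeAlgebra.lift_ι_apply]
  | mul_tgt a =>
      simp [vtxHomAux, map_mul, FreeAlgebra.lift_ι_apply]
  | src_zero w a hw =>
      simp [vtxHomAux, map_mul, FreeAlgebra.lift_ι_apply]
  | tgt_zero w a hw =>
      simp [vtxHomAux, map_mul, FreeAlgebra.lift_ι_apply]
  | rel_zero a b hab =>
      simp [vtxHomAux, map_mul, FreeAlgebra.lift_ι_apply]

/-- the ring map `A → k` corresponding to the vertex `v` -/
def vtxHom (v : Q.V) : GA k Q rel →+* k :=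
  RingQuot.lift ⟨(vtxHomAux k Q v).toRingHom, fun _ _ h => vtxHomAux_rel k Q rel v h⟩

/-- the ring map `A → k^{Q₀}` with kernel `A₊` -/
def SHom : GA k Q rel →+* (Q.V → k) := Pi.ringHom fun v => vtxHom k Q rel v

/-- the graded simple right `A`-module `S(v)` at the vertex `v` -/
def SvModR (v : Q.V) : ModuleCat (GA k Q rel)ᵐᵒᵖ :=
  @ModuleCat.of _ _ k _
    (Module.compHom k ((vtxHom k Q rel v).fromOpposite (fun _ _ => mul_comm _ _)))

/-- the graded simple left `A`-module `S(v)` at the vertex `v` -/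
def SvModL (v : Q.V) : ModuleCat (GA k Q rel) :=
  @ModuleCat.of _ _ k _ (Module.compHom k (vtxHom k Q rel v))

/-- `S = A/A₊ ≅ ⊕_v S(v)` as a right `A`-module -/
def SModR : ModuleCat (GA k Q rel)ᵐᵒᵖ :=
  @ModuleCat.of _ _ (Q.V → k) _
    (Module.compHom _ ((SHom k Q rel).fromOpposite (fun _ _ => mul_comm _ _)))

/-- `S = A/A₊` as a left `A`-module -/
def SModL : ModuleCat (GA k Q rel) :=
  @ModuleCat.of _ _ (Q.V → k) _ (Module.compHom _ (SHom k Q rel))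

/-- `A` as a right module over itself -/
def AModR : ModuleCat (GA k Q rel)ᵐᵒᵖ := ModuleCat.of _ (GA k Q rel)

/-- `A` as a left module over itself -/
def AModL : ModuleCat (GA k Q rel) := ModuleCat.of _ (GA k Q rel)

/-- nonvanishing of `Ext^i(M, N)` for modules over a ring `R` -/
def extNZ {R : Type} [Ring R] (i : ℕ) (M N : ModuleCat R) : Prop :=
  ¬ Subsingleton (((Ext ℤ (ModuleCat R) i).obj (Opposite.op M)).obj N)

/-- nonvanishing of `Ext^i_A(S(v), A)` in right `A`-modules.  (For the Noetherian graded
algebra `A` with the finitely generated modules `S(v)` and `A` this agrees with the graded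
`Ext`-group, summed over all shifts, used in the paper.) -/
def extSvNZ (i : ℕ) (v : Q.V) : Prop := extNZ i (SvModR k Q rel v) (AModR k Q rel)

/-- nonvanishing of `Ext^i_A(S, A)` in right `A`-modules -/
def extSNZ (i : ℕ) : Prop := extNZ i (SModR k Q rel) (AModR k Q rel)

/-- the depth of `A`: `min { i : Ext^i_A(S, A) ≠ 0 }` -/
def depth : ℕ∞ := sInf {n : ℕ∞ | ∃ i : ℕ, n = i ∧ extSNZ k Q rel i}

/-- the right self-injective dimension of `A`:
`sup { i : Ext^i(M, A) ≠ 0 for some right module M }` -/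
def rInjDim : ℕ∞ :=
  sSup {n : ℕ∞ | ∃ (i : ℕ) (M : ModuleCat.{0} (GA k Q rel)ᵐᵒᵖ), n = i ∧ extNZ i M (AModR k Q rel)}

/-- the left self-injective dimension of `A` -/
def lInjDim : ℕ∞ :=
  sSup {n : ℕ∞ | ∃ (i : ℕ) (M : ModuleCat.{0} (GA k Q rel)), n = i ∧ extNZ i M (AModL k Q rel)}

/-- the right global dimension of `A`: `sup { i : Ext^i(M, N) ≠ 0 }` over right modules -/
def rGlDim : ℕ∞ :=
  sSup {n : ℕ∞ | ∃ (i : ℕ) (M N : ModuleCat.{0} (GA k Q rel)ᵐᵒᵖ), n = i ∧ extNZ i M N}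

/-- the left global dimension of `A` -/
def lGlDim : ℕ∞ :=
  sSup {n : ℕ∞ | ∃ (i : ℕ) (M N : ModuleCat.{0} (GA k Q rel)), n = i ∧ extNZ i M N}

end LocGentle
namespace LocGentle


section Resolution

variable {R : Type} [Ring R] {M : ModuleCat.{0} R} (P : ℕ → ModuleCat.{0} R)
  (d : ∀ n, P (n + 1) ⟶ P n) (ε : P 0 ⟶ M)

theorem chainComplexOf_d (hdd : ∀ n, d (n + 1) ≫ d n = 0) (n : ℕ) :
    (ChainComplex.of P d hdd).d (n + 1) n = d n :=
  ChainComplex.of_d P d n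

/-- A projective resolution from a sequence of projective modules that is exact elementwise. -/
def resolutionOfExact (hP : ∀ n, Projective (P n)) (hdd : ∀ n, d (n + 1) ≫ d n = 0)
    (hdε : d 0 ≫ ε = 0) (hε : Function.Surjective ε)
    (h₀ : ∀ z : P 0, ε z = 0 → ∃ y, d 0 y = z)
    (hex : ∀ n, ∀ z : P (n + 1), d n z = 0 → ∃ y, d (n + 1) y = z) :
    ProjectiveResolution M where
  complex := ChainComplex.of P d hdd
  projective := hP
  π := (ChainComplex.toSingle₀Equiv _ _).symm ⟨ε, by rw [chainComplexOf_d]; exact hdε⟩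
  quasiIso := ⟨fun n => by
    cases n with
    | zero =>
      rw [ChainComplex.quasiIsoAt₀_iff, ShortComplex.quasiIso_iff_of_zeros' _ rfl rfl rfl]
      refine (ShortComplex.exact_and_epi_g_iff_of_iso
        (S₂ := ShortComplex.mk (d 0) ε hdε) ?_).2 ⟨?_, ?_⟩
      · exact ShortComplex.isoMk (Iso.refl _) (Iso.refl _) (Iso.refl _)
          ((Category.id_comp _).trans (((Category.comp_id _).trans
            (chainComplexOf_d P d hdd 0)).symm))
          ((Category.id_comp ε).trans (((Category.comp_id _).trans
            (ChainComplex.toSingle₀Equiv_symm_apply_f_zero (C := ChainComplex.of P d hdd) ε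
              (by rw [chainComplexOf_d]; exact hdε))).symm))
      · rw [ShortComplex.moduleCat_exact_iff]
        exact h₀
      · exact (ModuleCat.epi_iff_surjective _).2 hε
    | succ n =>
      rw [quasiIsoAt_iff_exactAt' (hL := ChainComplex.exactAt_succ_single_obj ..),
        HomologicalComplex.exactAt_iff' _ (n + 2) (n + 1) n (by simp) (by simp),
        ShortComplex.moduleCat_exact_iff]
      change ∀ z, (ChainComplex.of P d hdd).d (n + 1) n z = 0 →
        ∃ y, (ChainComplex.of P d hdd).d (n + 2) (n + 1) y = z
      rw [chainComplexOf_d, chainComplexOf_d]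
      exact hex n⟩

theorem not_extNZ_of_isZero (r : ProjectiveResolution M) (N : ModuleCat.{0} R) (i : ℕ)
    (h : Limits.IsZero (r.complex.X i)) : ¬ extNZ i M N := by
  rw [extNZ, not_not]
  refine @ModuleCat.subsingleton_of_isZero _ _ _ ?_
  refine Limits.IsZero.of_iso ?_ (r.isoExt i N)
  rw [← HomologicalComplex.exactAt_iff_isZero_homology, HomologicalComplex.exactAt_iff]
  refine ShortComplex.exact_of_isZero_X₂ _ ?_
  rw [Limits.IsZero.iff_id_eq_zero]
  ext (x : _ ⟶ _)
  exact h.eq_of_src _ _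

theorem extNZ_of_minimal (r : ProjectiveResolution M) (N : ModuleCat.{0} R) (i : ℕ)
    (h : ∀ m n, ∀ φ : r.complex.X n ⟶ N, r.complex.d m n ≫ φ = 0)
    (φ : r.complex.X i ⟶ N) (hφ : φ ≠ 0) : extNZ i M N := by
  rw [extNZ]
  intro hs
  have h1 : Limits.IsZero ((r.complex.linearYonedaObj ℤ N).homology i) :=
    Limits.IsZero.of_iso (ModuleCat.isZero_of_subsingleton _) (r.isoExt i N).symm
  rw [← HomologicalComplex.exactAt_iff_isZero_homology, HomologicalComplex.exactAt_iff,
    ShortComplex.moduleCat_exact_iff] at h1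
  obtain ⟨y, hy⟩ := h1 φ (h _ _ φ)
  exact hφ (hy.symm.trans (h _ _ y))

end Resolution

/-- The relations of `kQ/I`, for a family of idempotents and arrows in a ring. -/
structure QuadRels (Q : Quiv) (rel : Q.Arr → Q.Arr → Prop) {B : Type} [Ring B]
    (e : Q.V → B) (x : Q.Arr → B) : Prop where
  idem : ∀ v, e v * e v = e v
  orth : ∀ v w, v ≠ w → e v * e w = 0
  unit : ∑ v, e v = 1
  src_mul : ∀ a, e (Q.src a) * x a = x a
  mul_tgt : ∀ a, x a * e (Q.tgt a) = x a
  rel_zero : ∀ a b, rel a b → x a * x b = 0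

/-- A presentation of the `k`-algebra `R` as `kQ/I`. -/
structure Presentation (k : Type) [Field k] (Q : Quiv) (rel : Q.Arr → Q.Arr → Prop)
    (R : Type) [Ring R] [Algebra k R] where
  e : Q.V → R
  x : Q.Arr → R
  rels : QuadRels Q rel e x
  rel_comp : ∀ a b, rel a b → Q.tgt a = Q.src b
  lift : ∀ (B : Type) [Ring B] [Algebra k B] (E : Q.V → B) (X : Q.Arr → B),
    QuadRels Q rel E X → ∃ f : R →ₐ[k] B, (∀ v, f (e v) = E v) ∧ ∀ a, f (x a) = X a
  gen : ∀ S : Subalgebra k R, (∀ v, e v ∈ S) → (∀ a, x a ∈ S) → S = ⊤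

namespace Presentation

variable {k : Type} [Field k] {Q : Quiv} {rel : Q.Arr → Q.Arr → Prop}
  {R : Type} [Ring R] [Algebra k R] (P : Presentation k Q rel R)

open scoped Classical in
/-- Right multiplication by an arrow, together with the induced operation on tuples of
right Fox derivatives. -/
def foxArrow (a : Q.Arr) : Module.End k (R × (Q.Arr → R)) where
  toFun p := (p.1 * P.x a, Pi.single a
    (p.1 * P.e (Q.src a) - ∑ c, if rel c a then p.2 c * P.x c else 0))
  map_add' p q := by
    refine Prod.ext (add_mul _ _ _) ?_
    · change Pi.single a _ = Pi.single a _ + Pi.single a _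
      rw [← Pi.single_add]
      congr 1
      rw [Prod.fst_add, add_mul, sub_add_sub_comm, ← Finset.sum_add_distrib]
      congr 1
      refine Finset.sum_congr rfl fun c _ => ?_
      split_ifs <;> simp [add_mul]
  map_smul' r p := by
    refine Prod.ext (smul_mul_assoc _ _ _) ?_
    · change Pi.single a _ = r • Pi.single a _
      rw [← Pi.single_smul]
      congr 1
      rw [smul_sub, Finset.smul_sum]
      congr 1
      · simp
      · refine Finset.sum_congr rfl fun c _ => ?_
        split_ifs <;> simp

/-- Right multiplication by an idempotent, together with the induced operation on tuples of
right Fox derivatives. -/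
def foxVertex (v : Q.V) : Module.End k (R × (Q.Arr → R)) where
  toFun p := (p.1 * P.e v, fun b => if Q.tgt b = v then p.2 b else 0)
  map_add' p q := by
    ext b
    · simp [add_mul]
    · by_cases h : Q.tgt b = v <;> simp [h]
  map_smul' r p := by
    ext b
    · simp
    · by_cases h : Q.tgt b = v <;> simp [h]

theorem quadRels_fox : QuadRels Q rel (fun v => MulOpposite.op (P.foxVertex v))
    (fun a => MulOpposite.op (P.foxArrow a)) where
  idem v := by
    rw [← MulOpposite.op_mul]
    congr 1
    refine LinearMap.ext fun p => Prod.ext ?_ (funext fun b => ?_)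
    · simp [foxVertex, P.rels.idem, mul_assoc]
    · by_cases h : Q.tgt b = v <;> simp [foxVertex, h]
  orth v w h := by
    rw [← MulOpposite.op_mul, ← MulOpposite.op_zero]
    congr 1
    refine LinearMap.ext fun p => Prod.ext ?_ (funext fun b => ?_)
    · simp [foxVertex, mul_assoc, P.rels.orth v w h]
    · simp only [foxVertex, Module.End.mul_apply, LinearMap.coe_mk, AddHom.coe_mk,
        LinearMap.zero_apply, Prod.snd_zero, Pi.zero_apply]
      split_ifs with h1 h2
      · exact absurd (h2.symm.trans h1) h
      · rfl
      · rfl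
  unit := by
    rw [← Finset.op_sum, ← MulOpposite.op_one]
    congr 1
    refine LinearMap.ext fun p => Prod.ext ?_ (funext fun b => ?_)
    · simp [foxVertex, LinearMap.sum_apply, Prod.fst_sum, ← Finset.mul_sum, P.rels.unit]
    · simp [foxVertex, LinearMap.sum_apply, Prod.snd_sum]
  src_mul a := by
    rw [← MulOpposite.op_mul]
    congr 1
    refine LinearMap.ext fun p => Prod.ext ?_ ?_
    · simp [foxVertex, foxArrow, mul_assoc, P.rels.src_mul]
    · simp only [foxVertex, foxArrow, Module.End.mul_apply, LinearMap.coe_mk, AddHom.coe_mk,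
        mul_assoc, P.rels.idem]
      congr 2
      refine Finset.sum_congr rfl fun c _ => ?_
      by_cases h : rel c a
      · simp [h, P.rel_comp c a h]
      · simp [h]
  mul_tgt a := by
    rw [← MulOpposite.op_mul]
    congr 1
    refine LinearMap.ext fun p => Prod.ext ?_ (funext fun b => ?_)
    · simp [foxVertex, foxArrow, mul_assoc, P.rels.mul_tgt]
    · simp only [foxVertex, foxArrow, Module.End.mul_apply, LinearMap.coe_mk, AddHom.coe_mk]
      rcases eq_or_ne b a with rfl | h
      · simp
      · simp [h]
  rel_zero a b h := by
    rw [← MulOpposite.op_mul, ← MulOpposite.op_zero]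
    congr 1
    refine LinearMap.ext fun p => Prod.ext ?_ ?_
    · simp [foxArrow, mul_assoc, P.rels.rel_zero a b h]
    · simp only [foxArrow, Module.End.mul_apply, LinearMap.coe_mk, AddHom.coe_mk,
        LinearMap.zero_apply, Prod.snd_zero]
      rw [Pi.single_eq_zero_iff, Finset.sum_eq_single a]
      · rw [if_pos h, Pi.single_eq_same, sub_mul, mul_assoc p.1 (P.e _), P.rels.src_mul,
          mul_assoc p.1, ← P.rel_comp a b h, P.rels.mul_tgt, Finset.sum_mul, Finset.sum_eq_zero, sub_zero,
          sub_self]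
        intro c _
        split_ifs with hc
        · rw [mul_assoc, P.rels.rel_zero c a hc, mul_zero]
        · rw [zero_mul]
      · intro c _ hc
        simp [hc]
      · simp

open scoped Classical in
/-- The right Fox derivatives: `δ b` strips the arrow `b` from the end of a path. -/
theorem exists_fox : ∃ δ : Q.Arr → R →ₗ[k] R,
    (∀ b y, δ b y * P.e (Q.src b) = δ b y) ∧
    ∀ a b y, δ b (y * P.x a) = if b = a then
      y * P.e (Q.src a) - ∑ c, (if rel c a then δ c y * P.x c else 0) else 0 := by
  obtain ⟨f, hfe, hfx⟩ := P.lift _ _ _ P.quadRels_fox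
  have hfst : ∀ y, ∀ u, ((f y).unop u).1 = u.1 * y := by
    let S : Subalgebra k R :=
      { carrier := {y | ∀ u, ((f y).unop u).1 = u.1 * y}
        mul_mem' := fun {y z} hy hz u => by
          rw [map_mul, MulOpposite.unop_mul, Module.End.mul_apply, hz, hy, mul_assoc]
        add_mem' := fun {y z} hy hz u => by
          rw [map_add, MulOpposite.unop_add, LinearMap.add_apply, Prod.fst_add, hy, hz, mul_add]
        algebraMap_mem' := fun r u => by
          rw [AlgHom.commutes, MulOpposite.algebraMap_apply, MulOpposite.unop_op,
            Module.algebraMap_end_apply, Prod.smul_fst, ← Algebra.commutes, Algebra.smul_def] }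
    have hS : S = ⊤ := P.gen S
      (fun v u => by rw [hfe]; rfl) (fun a u => by rw [hfx]; rfl)
    intro y
    have : y ∈ S := hS ▸ Algebra.mem_top
    exact this
  let δ (b : Q.Arr) : R →ₗ[k] R :=
    { toFun := fun y => ((f y).unop (1, 0)).2 b * P.e (Q.src b)
      map_add' := fun y z => by simp [add_mul]
      map_smul' := fun r y => by simp }
  refine ⟨δ, fun b y => ?_, fun a b y => ?_⟩
  · simp only [δ, LinearMap.coe_mk, AddHom.coe_mk, mul_assoc, P.rels.idem]
  · simp only [δ, LinearMap.coe_mk, AddHom.coe_mk, mul_assoc, P.rels.src_mul]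
    rw [map_mul, MulOpposite.unop_mul, Module.End.mul_apply, hfx, MulOpposite.unop_op]
    simp only [foxArrow, LinearMap.coe_mk, AddHom.coe_mk, hfst, one_mul]
    split_ifs with h
    · subst h
      rw [Pi.single_eq_same, sub_mul, mul_assoc, P.rels.idem, Finset.sum_mul]
      congr 1
      refine Finset.sum_congr rfl fun c _ => ?_
      split_ifs with hc
      · rw [mul_assoc, ← P.rel_comp c b hc, P.rels.mul_tgt]
      · rw [zero_mul]
    · rw [Pi.single_eq_of_ne h, zero_mul]

end Presentation

section Derivation

variable {k : Type} [Field k] {Q : Quiv} {rel : Q.Arr → Q.Arr → Prop}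
  {R : Type} [Ring R] [Algebra k R] (P : Presentation k Q rel R)
  {M : Type} [AddCommGroup M] [Module k M] [Module R M] [IsScalarTower k R M]
  {C : Type} [AddCommGroup C] [Module k C]

namespace Presentation

/-- Right multiplication by an arrow, twisted by a bilinear form `q`. -/
def derivArrow (q : R →ₗ[k] M →ₗ[k] C) (a : Q.Arr) :
    Module.End k (R × (M →ₗ[k] C)) where
  toFun p := (p.1 * P.x a, p.2 ∘ₗ Algebra.lsmul k k M (P.x a) + q p.1)
  map_add' p p' := by
    refine Prod.ext (add_mul _ _ _) ?_
    simp only [Prod.snd_add, Prod.fst_add, map_add, LinearMap.add_comp]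
    abel
  map_smul' r p := by
    refine Prod.ext (smul_mul_assoc _ _ _) ?_
    simp [LinearMap.smul_comp]

/-- Right multiplication by an idempotent on pairs. -/
def derivVertex (v : Q.V) : Module.End k (R × (M →ₗ[k] C)) where
  toFun p := (p.1 * P.e v, p.2 ∘ₗ Algebra.lsmul k k M (P.e v))
  map_add' _ _ := Prod.ext (add_mul _ _ _) (LinearMap.add_comp _ _ _)
  map_smul' _ _ := Prod.ext (smul_mul_assoc _ _ _) (LinearMap.smul_comp _ _ _)

/-- A family of bilinear forms compatible with the relations integrates to a Hochschild
cochain. -/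
theorem exists_integral (q : Q.Arr → R →ₗ[k] M →ₗ[k] C)
    (hsrc : ∀ a u, q a (u * P.e (Q.src a)) = q a u)
    (htgt : ∀ a u m, q a u (P.e (Q.tgt a) • m) = q a u m)
    (hrel : ∀ a b u m, rel a b → q a u (P.x b • m) + q b (u * P.x a) m = 0) :
    ∃ H : R →ₗ[k] M →ₗ[k] C, ∀ y a m, H (y * P.x a) m = H y (P.x a • m) + q a y m := by
  have hq : QuadRels Q rel
      (fun v => MulOpposite.op (P.derivVertex v : Module.End k (R × (M →ₗ[k] C))))
      (fun a => MulOpposite.op (P.derivArrow (q a) a)) := by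
    have key : ∀ f g : Module.End k (R × (M →ₗ[k] C)),
        (∀ p, (f p).1 = (g p).1) → (∀ p m, (f p).2 m = (g p).2 m) → f = g :=
      fun f g h1 h2 => LinearMap.ext fun p => Prod.ext (h1 p) (LinearMap.ext (h2 p))
    constructor
    · intro v
      rw [← MulOpposite.op_mul]
      refine congrArg _ (key _ _ (fun p => ?_) fun p m => ?_)
      · simp [derivVertex, mul_assoc, P.rels.idem]
      · simp [derivVertex, ← mul_smul, P.rels.idem]
    · intro v w h
      rw [← MulOpposite.op_mul, ← MulOpposite.op_zero]
      refine congrArg _ (key _ _ (fun p => ?_) fun p m => ?_)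
      · simp [derivVertex, mul_assoc, P.rels.orth v w h]
      · simp [derivVertex, ← mul_smul, P.rels.orth v w h]
    · rw [← Finset.op_sum, ← MulOpposite.op_one]
      refine congrArg _ (key _ _ (fun p => ?_) fun p m => ?_)
      · simp [derivVertex, LinearMap.sum_apply, Prod.fst_sum, ← Finset.mul_sum, P.rels.unit]
      · simp [derivVertex, LinearMap.sum_apply, Prod.snd_sum, ← map_sum, ← Finset.sum_smul,
          P.rels.unit]
    · intro a
      rw [← MulOpposite.op_mul]
      refine congrArg _ (key _ _ (fun p => ?_) fun p m => ?_)
      · simp [derivVertex, derivArrow, mul_assoc, P.rels.src_mul]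
      · simp [derivVertex, derivArrow, ← mul_smul, P.rels.src_mul, hsrc]
    · intro a
      rw [← MulOpposite.op_mul]
      refine congrArg _ (key _ _ (fun p => ?_) fun p m => ?_)
      · simp [derivVertex, derivArrow, mul_assoc, P.rels.mul_tgt]
      · simp [derivVertex, derivArrow, ← mul_smul, P.rels.mul_tgt, htgt]
    · intro a b h
      rw [← MulOpposite.op_mul, ← MulOpposite.op_zero]
      refine congrArg _ (key _ _ (fun p => ?_) fun p m => ?_)
      · simp [derivArrow, mul_assoc, P.rels.rel_zero a b h]
      · simp [derivArrow, ← mul_smul, P.rels.rel_zero a b h, hrel a b _ _ h]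
  obtain ⟨f, hfe, hfx⟩ := P.lift _ _ _ hq
  have hfst : ∀ y, ∀ u, ((f y).unop u).1 = u.1 * y := by
    let S : Subalgebra k R :=
      { carrier := {y | ∀ u, ((f y).unop u).1 = u.1 * y}
        mul_mem' := fun {y z} hy hz u => by
          rw [map_mul, MulOpposite.unop_mul, Module.End.mul_apply, hz, hy, mul_assoc]
        add_mem' := fun {y z} hy hz u => by
          rw [map_add, MulOpposite.unop_add, LinearMap.add_apply, Prod.fst_add, hy, hz, mul_add]
        algebraMap_mem' := fun r u => by
          rw [AlgHom.commutes, MulOpposite.algebraMap_apply, MulOpposite.unop_op,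
            Module.algebraMap_end_apply, Prod.smul_fst, ← Algebra.commutes, Algebra.smul_def] }
    have hS : S = ⊤ := P.gen S
      (fun v u => by rw [hfe]; rfl) (fun a u => by rw [hfx]; rfl)
    intro y
    have : y ∈ S := hS ▸ Algebra.mem_top
    exact this
  refine ⟨{ toFun := fun y => ((f y).unop (1, 0)).2
            map_add' := fun y z => by simp
            map_smul' := fun r y => by simp }, fun y a m => ?_⟩
  simp only [LinearMap.coe_mk, AddHom.coe_mk]
  rw [map_mul, MulOpposite.unop_mul, Module.End.mul_apply, hfx, MulOpposite.unop_op]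
  simp [derivArrow, hfst]

end Presentation

end Derivation

section Koszul

open TensorProduct

namespace Presentation

set_option linter.unusedSectionVars false

variable {k : Type} [Field k] {Q : Quiv} {rel : Q.Arr → Q.Arr → Prop}
  {R : Type} [Ring R] [Algebra k R] (P : Presentation k Q rel R)
  (M : Type) [AddCommGroup M] [Module k M] [Module R M] [IsScalarTower k R M]

/-- The free left module containing the terms of the Koszul complex. -/
abbrev KFree (_ : Presentation k Q rel R) : Type := R ⊗[k] ((Q.V × List Q.Arr) →₀ M)

variable {M}

/-- The elementary tensor `y ⊗ (v, l) ⊗ m`. -/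
def kgen (v : Q.V) (l : List Q.Arr) (y : R) (m : M) : P.KFree M :=
  y ⊗ₜ[k] Finsupp.single (v, l) m

/-- The `R`-linear extension of a `k`-linear map. -/
def kExtend {X : Type} [AddCommGroup X] [Module k X] [Module R X] [IsScalarTower k R X]
    (f : (Q.V × List Q.Arr) → M →ₗ[k] X) : P.KFree M →ₗ[R] X :=
  AlgebraTensorModule.lift (LinearMap.toSpanSingleton R (_ →ₗ[k] X) (Finsupp.lsum ℕ f))

theorem kExtend_kgen {X : Type} [AddCommGroup X] [Module k X] [Module R X] [IsScalarTower k R X]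
    (f : (Q.V × List Q.Arr) → M →ₗ[k] X) (v : Q.V) (l) (y : R) (m : M) :
    P.kExtend f (P.kgen v l y m) = y • f (v, l) m := by
  simp [kExtend, kgen]

/-- The elementary tensor `r ⊗ (v, l) ⊗ s m`, as a linear function of `m`. -/
def kTwist (v : Q.V) (l : List Q.Arr) (r s : R) : M →ₗ[k] P.KFree M :=
  TensorProduct.mk k R _ r ∘ₗ Finsupp.lsingle (v, l) ∘ₗ Algebra.lsmul k k M s

theorem smul_kTwist (v : Q.V) (l : List Q.Arr) (r s y : R) (m : M) :
    y • P.kTwist v l r s m = P.kgen v l (y * r) (s • m) := by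
  simp [kTwist, kgen, smul_tmul']

theorem kgen_add_left (v : Q.V) (l) (y z : R) (m : M) :
    P.kgen v l (y + z) m = P.kgen v l y m + P.kgen v l z m :=
  add_tmul _ _ _

theorem kgen_sub_left (v : Q.V) (l) (y z : R) (m : M) :
    P.kgen v l (y - z) m = P.kgen v l y m - P.kgen v l z m :=
  sub_tmul _ _ _

theorem kgen_sum_left {ι : Type} (s : Finset ι) (v : Q.V) (l) (y : ι → R) (m : M) :
    P.kgen v l (∑ i ∈ s, y i) m = ∑ i ∈ s, P.kgen v l (y i) m :=
  sum_tmul _ _ _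

@[simp] theorem kgen_zero_left (v : Q.V) (l) (m : M) : P.kgen v l 0 m = 0 :=
  zero_tmul _ _

@[simp] theorem kgen_zero_right (v : Q.V) (l) (y : R) : P.kgen v l y (0 : M) = 0 := by
  simp [kgen]

variable (M) in
/-- Removing the first arrow. -/
def dHead : P.KFree M →ₗ[R] P.KFree M :=
  P.kExtend fun i => match i.2 with
    | [] => 0
    | a :: l => P.kTwist (Q.tgt a) l (P.x a) 1

variable (M) in
/-- Removing the last arrow. -/
def dLast : P.KFree M →ₗ[R] P.KFree M :=
  P.kExtend fun i => match i.2.getLast? with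
    | none => 0
    | some z => P.kTwist i.1 i.2.dropLast 1 (P.x z)

variable (M) in
/-- The augmentation of the Koszul complex. -/
def kAug : P.KFree M →ₗ[R] M :=
  P.kExtend fun i => match i.2 with
    | [] => LinearMap.id
    | _ :: _ => 0

variable (M) in
/-- The differential on words of length `n + 1`. -/
def kDiff (n : ℕ) : P.KFree M →ₗ[R] P.KFree M :=
  P.dHead M + (-1 : ℤ) ^ (n + 1) • P.dLast M

@[simp] theorem dHead_nil (v : Q.V) (y : R) (m : M) : P.dHead M (P.kgen v [] y m) = 0 := by
  simp [dHead, kExtend_kgen]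

@[simp] theorem dHead_cons (v : Q.V) (a l) (y : R) (m : M) :
    P.dHead M (P.kgen v (a :: l) y m) = P.kgen (Q.tgt a) l (y * P.x a) m := by
  simp [dHead, kExtend_kgen, smul_kTwist]

@[simp] theorem dLast_nil (v : Q.V) (y : R) (m : M) : P.dLast M (P.kgen v [] y m) = 0 := by
  simp [dLast, kExtend_kgen]

@[simp] theorem dLast_concat (v : Q.V) (l z) (y : R) (m : M) :
    P.dLast M (P.kgen v (l ++ [z]) y m) = P.kgen v l y (P.x z • m) := by
  rw [dLast, kExtend_kgen, List.getLast?_concat, List.dropLast_concat]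
  simp [smul_kTwist]

@[simp] theorem kAug_nil (v : Q.V) (y : R) (m : M) : P.kAug M (P.kgen v [] y m) = y • m := by
  simp [kAug, kExtend_kgen]

/-- The words labelling the `n`-th term of the Koszul complex. -/
def KValid (_ : Presentation k Q rel R) (n : ℕ) (i : Q.V × List Q.Arr) : Prop :=
  i.2.length = n ∧ (∀ a ∈ i.2.head?, Q.src a = i.1) ∧ i.2.IsChain rel

open scoped Classical in
variable (M) in
/-- The idempotent cutting out the `n`-th term of the Koszul complex. -/
def kProj (n : ℕ) : P.KFree M →ₗ[R] P.KFree M :=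
  P.kExtend fun i => if P.KValid n i then
    P.kTwist i.1 i.2 (P.e i.1) (P.e (wTgtD i.2 i.1)) else 0

variable (M) in
/-- The `n`-th term of the Koszul complex. -/
def kTerm (n : ℕ) : Submodule R (P.KFree M) := LinearMap.range (P.kProj M n)

theorem kProj_kgen {n : ℕ} {v : Q.V} {l} (h : P.KValid n (v, l)) (y : R) (m : M) :
    P.kProj M n (P.kgen v l y m) = P.kgen v l (y * P.e v) (P.e (wTgtD l v) • m) := by
  simp [kProj, kExtend_kgen, smul_kTwist, h]

theorem kProj_kgen_of_not {n : ℕ} {v : Q.V} {l} (h : ¬ P.KValid n (v, l)) (y : R) (m : M) :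
    P.kProj M n (P.kgen v l y m) = 0 := by
  simp [kProj, kExtend_kgen, h]

/-- The normalized elementary tensors of the `n`-th term. -/
structure KNormal (n : ℕ) (v : Q.V) (l : List Q.Arr) (y : R) (m : M) : Prop where
  valid : P.KValid n (v, l)
  left : y * P.e v = y
  right : P.e (wTgtD l v) • m = m

variable {P}

theorem KNormal.kProj {n : ℕ} {v : Q.V} {l} {y : R} {m : M} (h : P.KNormal n v l y m) :
    P.kProj M n (P.kgen v l y m) = P.kgen v l y m := by
  rw [P.kProj_kgen h.valid, h.left, h.right]

theorem KNormal.mem {n : ℕ} {v : Q.V} {l} {y : R} {m : M} (h : P.KNormal n v l y m) :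
    P.kgen v l y m ∈ P.kTerm M n := ⟨_, h.kProj⟩

variable (P)

theorem kFree_induction {p : P.KFree M → Prop} (h0 : p 0) (hadd : ∀ z w, p z → p w → p (z + w))
    (hgen : ∀ v l y m, p (P.kgen v l y m)) (z : P.KFree M) : p z := by
  induction z using TensorProduct.induction_on with
  | zero => exact h0
  | add z w hz hw => exact hadd _ _ hz hw
  | tmul y t =>
    induction t using Finsupp.induction_linear with
    | zero => simpa using h0
    | single i m => exact hgen i.1 i.2 y m
    | add t u ht hu => rw [tmul_add]; exact hadd _ _ ht hu

theorem kTerm_induction {n : ℕ} {p : P.KFree M → Prop} (h0 : p 0)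
    (hadd : ∀ z w, p z → p w → p (z + w))
    (hgen : ∀ v l y m, P.KNormal n v l y m → p (P.kgen v l y m))
    {z : P.KFree M} (hz : z ∈ P.kTerm M n) : p z := by
  obtain ⟨w, rfl⟩ := hz
  refine P.kFree_induction (p := fun w => p (P.kProj M n w)) ?_ ?_ ?_ w
  · simpa using h0
  · intro z w hz hw
    rw [map_add]
    exact hadd _ _ hz hw
  · intro v l y m
    by_cases h : P.KValid n (v, l)
    · rw [P.kProj_kgen h]
      refine hgen _ _ _ _ ⟨h, ?_, ?_⟩
      · rw [mul_assoc, P.rels.idem]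
      · rw [← mul_smul, P.rels.idem]
    · rw [P.kProj_kgen_of_not h]; exact h0

variable (M) in
theorem projective_kTerm (n : ℕ) : Module.Projective R (P.kTerm M n) := by
  refine Module.Projective.of_split (P.kTerm M n).subtype (P.kProj M n).rangeRestrict ?_
  refine LinearMap.ext fun z => Subtype.ext ?_
  refine P.kTerm_induction (p := fun z => P.kProj M n z = z) (map_zero _) ?_ ?_ z.2
  · intro z w hz hw
    rw [map_add, hz, hw]
  · exact fun v l y m h => h.kProj

theorem wTgtD_cons (a : Q.Arr) (l : List Q.Arr) (v : Q.V) :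
    wTgtD (a :: l) v = wTgtD l (Q.tgt a) := by
  cases l using List.reverseRecOn with
  | nil => rfl
  | append_singleton l z =>
    rw [← List.cons_append]
    simp only [wTgtD, List.getLast?_concat, Option.map_some, Option.getD_some]

theorem wTgtD_concat (l : List Q.Arr) (z : Q.Arr) (v : Q.V) :
    wTgtD (l ++ [z]) v = Q.tgt z := by
  simp [wTgtD]

variable {P}

theorem KNormal.tail {n : ℕ} {v : Q.V} {a l} {y : R} {m : M}
    (h : P.KNormal (n + 1) v (a :: l) y m) :
    P.KNormal n (Q.tgt a) l (y * P.x a) m := by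
  obtain ⟨⟨h1, h2, h3⟩, h4, h5⟩ := h
  refine ⟨⟨by simpa using h1, ?_, h3.tail⟩, ?_, ?_⟩
  · cases l with
    | nil => simp
    | cons b l =>
      simp only [List.head?_cons, Option.mem_def, Option.some.injEq, forall_eq']
      exact (P.rel_comp a b (List.isChain_cons_cons.1 h3).1).symm
  · rw [mul_assoc, P.rels.mul_tgt]
  · rwa [wTgtD_cons] at h5

theorem KValid.wTgtD_eq {n : ℕ} {v : Q.V} {l z} (h : P.KValid n (v, l ++ [z])) :
    wTgtD l v = Q.src z := by
  obtain ⟨h1, h2, h3⟩ := h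
  cases l using List.reverseRecOn with
  | nil => simpa [wTgtD, eq_comm] using h2
  | append_singleton l c =>
    rw [wTgtD_concat]
    refine P.rel_comp c z ?_
    simp only [List.append_assoc] at h3
    simpa using h3.right_of_append

theorem KNormal.dropLast {n : ℕ} {v : Q.V} {l z} {y : R} {m : M}
    (h : P.KNormal (n + 1) v (l ++ [z]) y m) :
    P.KNormal n v l y (P.x z • m) := by
  refine ⟨⟨by simpa using h.valid.1, ?_, h.valid.2.2.left_of_append⟩, h.left, ?_⟩
  · cases l with
    | nil => simp
    | cons b l => simpa using h.valid.2.1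
  · rw [h.valid.wTgtD_eq, ← mul_smul, P.rels.src_mul]

variable (P)

theorem dHead_mem {n : ℕ} {z : P.KFree M} (hz : z ∈ P.kTerm M (n + 1)) :
    P.dHead M z ∈ P.kTerm M n := by
  refine P.kTerm_induction (p := fun z => P.dHead M z ∈ P.kTerm M n) (by simp) ?_ ?_ hz
  · intro z w hz hw
    rw [map_add]; exact add_mem hz hw
  · intro v l y m h
    cases l with
    | nil => simp
    | cons a l => rw [dHead_cons]; exact h.tail.mem

theorem dLast_mem {n : ℕ} {z : P.KFree M} (hz : z ∈ P.kTerm M (n + 1)) :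
    P.dLast M z ∈ P.kTerm M n := by
  refine P.kTerm_induction (p := fun z => P.dLast M z ∈ P.kTerm M n) (by simp) ?_ ?_ hz
  · intro z w hz hw
    rw [map_add]; exact add_mem hz hw
  · intro v l y m h
    cases l using List.reverseRecOn with
    | nil => simp
    | append_singleton l a => rw [dLast_concat]; exact h.dropLast.mem

theorem kDiff_mem {n : ℕ} {z : P.KFree M} (hz : z ∈ P.kTerm M (n + 1)) :
    P.kDiff M n z ∈ P.kTerm M n := by
  rw [kDiff, LinearMap.add_apply, LinearMap.smul_apply]
  exact add_mem (P.dHead_mem hz) (zsmul_mem (P.dLast_mem hz) _)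

theorem dHead_dHead {n : ℕ} {z : P.KFree M} (hz : z ∈ P.kTerm M n) :
    P.dHead M (P.dHead M z) = 0 := by
  refine P.kTerm_induction (p := fun z => P.dHead M (P.dHead M z) = 0) (by simp) ?_ ?_ hz
  · intro z w hz hw
    rw [map_add, map_add, hz, hw, add_zero]
  · intro v l y m h
    match l with
    | [] => simp
    | [a] => simp
    | a :: b :: l =>
      rw [dHead_cons, dHead_cons, mul_assoc,
        P.rels.rel_zero a b (List.isChain_cons_cons.1 h.valid.2.2).1, mul_zero, kgen_zero_left]

theorem dLast_dLast {n : ℕ} {z : P.KFree M} (hz : z ∈ P.kTerm M n) :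
    P.dLast M (P.dLast M z) = 0 := by
  refine P.kTerm_induction (p := fun z => P.dLast M (P.dLast M z) = 0) (by simp) ?_ ?_ hz
  · intro z w hz hw
    rw [map_add, map_add, hz, hw, add_zero]
  · intro v l y m h
    cases l using List.reverseRecOn with
    | nil => simp
    | append_singleton l a =>
      rw [dLast_concat]
      cases l using List.reverseRecOn with
      | nil => simp
      | append_singleton l b =>
        have hba : rel b a := by
          have h3 := h.valid.2.2
          simp only [List.append_assoc] at h3
          simpa using h3.right_of_append
        rw [dLast_concat, ← mul_smul, P.rels.rel_zero b a hba, zero_smul, kgen_zero_right]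

theorem dLast_dHead {n : ℕ} {z : P.KFree M} (hz : z ∈ P.kTerm M (n + 2)) :
    P.dLast M (P.dHead M z) = P.dHead M (P.dLast M z) := by
  refine P.kTerm_induction (p := fun z => P.dLast M (P.dHead M z) = P.dHead M (P.dLast M z))
    (by simp) ?_ ?_ hz
  · intro z w hz hw
    simp only [map_add, hz, hw]
  · intro v l y m h
    match l with
    | [] => simp
    | a :: l =>
      cases l using List.reverseRecOn with
      | nil => exact absurd h.valid.1 (by simp)
      | append_singleton l z =>
        rw [dHead_cons, dLast_concat, ← List.cons_append, dLast_concat, dHead_cons]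

theorem kDiff_kDiff {n : ℕ} {z : P.KFree M} (hz : z ∈ P.kTerm M (n + 2)) :
    P.kDiff M n (P.kDiff M (n + 1) z) = 0 := by
  simp only [kDiff, LinearMap.add_apply, LinearMap.smul_apply, map_add, map_zsmul,
    P.dHead_dHead hz, P.dLast_dLast hz, P.dLast_dHead hz, pow_succ, smul_zero]
  module

theorem kAug_kDiff {z : P.KFree M} (hz : z ∈ P.kTerm M 1) : P.kAug M (P.kDiff M 0 z) = 0 := by
  refine P.kTerm_induction (p := fun z => P.kAug M (P.kDiff M 0 z) = 0) (by simp) ?_ ?_ hz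
  · intro z w hz hw
    rw [map_add, map_add, hz, hw, add_zero]
  · intro v l y m h
    obtain ⟨a, rfl⟩ := List.length_eq_one_iff.1 h.valid.1
    have := P.dLast_concat v [] a y m
    rw [List.nil_append] at this
    simp [kDiff, this, mul_smul]

end Presentation

end Koszul

section Exactness

open TensorProduct

namespace Presentation

set_option linter.unusedSectionVars false

variable {k : Type} [Field k] {Q : Quiv} {rel : Q.Arr → Q.Arr → Prop}
  {R : Type} [Ring R] [Algebra k R] (P : Presentation k Q rel R)
  {M : Type} [AddCommGroup M] [Module k M] [Module R M] [IsScalarTower k R M]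

variable (M) in
/-- The section `y ⊗ m ↦ ∑ y eᵥ ⊗ (v, []) ⊗ eᵥ m` of the augmentation. -/
def kSection : R ⊗[k] M →ₗ[R] P.KFree M :=
  AlgebraTensorModule.lift (LinearMap.toSpanSingleton R (M →ₗ[k] P.KFree M)
    (∑ v, P.kTwist v [] (P.e v) (P.e v)))

theorem kSection_tmul (y : R) (m : M) :
    P.kSection M (y ⊗ₜ m) = ∑ v, P.kgen v [] (y * P.e v) (P.e v • m) := by
  simp [kSection, LinearMap.sum_apply, Finset.smul_sum, smul_kTwist]

theorem kSection_of_right {v : Q.V} {y : R} {m : M} (h : P.e v • m = m) :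
    P.kSection M (y ⊗ₜ m) = P.kgen v [] (y * P.e v) m := by
  rw [kSection_tmul, Finset.sum_eq_single v, h]
  · intro w _ hw
    rw [← h, ← mul_smul, P.rels.orth w v hw, zero_smul, kgen_zero_right]
  · simp

theorem kSection_of_left {v : Q.V} {y : R} {m : M} (h : y * P.e v = y) :
    P.kSection M (y ⊗ₜ m) = P.kgen v [] y (P.e v • m) := by
  rw [kSection_tmul, Finset.sum_eq_single v, h]
  · intro w _ hw
    rw [← h, mul_assoc, P.rels.orth v w hw.symm, mul_zero, kgen_zero_left]
  · simp

theorem kSection_mem (t : R ⊗[k] M) : P.kSection M t ∈ P.kTerm M 0 := by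
  induction t using TensorProduct.induction_on with
  | zero => simp
  | add t u ht hu => rw [map_add]; exact add_mem ht hu
  | tmul y m =>
    rw [kSection_tmul]
    refine sum_mem fun v _ => KNormal.mem ⟨⟨rfl, by simp, by simp⟩, ?_, ?_⟩
    · rw [mul_assoc, P.rels.idem]
    · rw [← mul_smul]
      exact congrArg (· • m) (P.rels.idem v)

theorem kAug_kSection (y : R) (m : M) : P.kAug M (P.kSection M (y ⊗ₜ m)) = y • m := by
  rw [kSection_tmul]
  simp [← mul_smul, mul_assoc, P.rels.idem, ← Finset.sum_smul, ← Finset.mul_sum, P.rels.unit]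

theorem kNormal_arrow (a : Q.Arr) (y : R) (m : M) :
    P.KNormal 1 (Q.src a) [a] (y * P.e (Q.src a)) (P.e (Q.tgt a) • m) := by
  refine ⟨⟨rfl, by simp, by simp⟩, ?_, ?_⟩
  · rw [mul_assoc, P.rels.idem]
  · rw [← mul_smul]
    exact congrArg (· • m) (P.rels.idem _)

theorem dLast_single (v : Q.V) (a : Q.Arr) (y : R) (m : M) :
    P.dLast M (P.kgen v [a] y m) = P.kgen v [] y (P.x a • m) :=
  P.dLast_concat v [] a y m

theorem kDiff_single (v : Q.V) (a : Q.Arr) (y : R) (m : M) :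
    P.kDiff M 0 (P.kgen v [a] y m) =
      P.kgen (Q.tgt a) [] (y * P.x a) m - P.kgen v [] y (P.x a • m) := by
  simp [kDiff, dLast_single, sub_eq_add_neg]

theorem kSection_sub_mem (r : R) : ∀ (u : R) (m : M),
    P.kSection M ((u * r) ⊗ₜ m) - P.kSection M (u ⊗ₜ (r • m)) ∈
      (P.kTerm M 1).map (P.kDiff M 0) := by
  let S : Subalgebra k R :=
    { carrier := {r | ∀ (u : R) (m : M),
        P.kSection M ((u * r) ⊗ₜ m) - P.kSection M (u ⊗ₜ (r • m)) ∈
          (P.kTerm M 1).map (P.kDiff M 0)}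
      mul_mem' := fun {r s} hr hs u m => by
        have := add_mem (hs (u * r) m) (hr u (s • m))
        rwa [sub_add_sub_cancel, mul_assoc, ← mul_smul] at this
      add_mem' := fun {r s} hr hs u m => by
        have := add_mem (hr u m) (hs u m)
        rwa [← map_sub, ← map_sub, ← map_add, sub_add_sub_comm, ← add_tmul, ← tmul_add,
          ← mul_add, ← add_smul, map_sub] at this
      algebraMap_mem' := fun c u m => by
        rw [← Algebra.commutes, ← Algebra.smul_def, algebraMap_smul, smul_tmul, sub_self]
        exact zero_mem _ }
  have hS : S = ⊤ := by
    refine P.gen S (fun v u m => ?_) (fun a u m => ?_)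
    · rw [P.kSection_of_left (v := v), P.kSection_of_right (v := v), sub_self]
      · exact zero_mem _
      · rw [← mul_smul, P.rels.idem]
      · rw [mul_assoc, P.rels.idem]
    · rw [P.kSection_of_left (v := Q.tgt a), P.kSection_of_right (v := Q.src a)]
      · refine ⟨_, (P.kNormal_arrow a u m).mem, ?_⟩
        rw [kDiff_single, mul_assoc, P.rels.src_mul, ← mul_smul, P.rels.mul_tgt]
      · rw [← mul_smul, P.rels.src_mul]
      · rw [mul_assoc, P.rels.mul_tgt]
  have : r ∈ S := hS ▸ Algebra.mem_top
  exact this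

theorem sub_kSection_kAug_mem {z : P.KFree M} (hz : z ∈ P.kTerm M 0) :
    z - P.kSection M (1 ⊗ₜ P.kAug M z) ∈ (P.kTerm M 1).map (P.kDiff M 0) := by
  refine P.kTerm_induction (p := fun z => z - P.kSection M (1 ⊗ₜ P.kAug M z) ∈
    (P.kTerm M 1).map (P.kDiff M 0)) ?_ ?_ ?_ hz
  · simp
  · intro z w hz hw
    have := add_mem hz hw
    rwa [sub_add_sub_comm, ← map_add, ← tmul_add, ← map_add] at this
  · intro v l y m h
    obtain rfl := List.length_eq_zero_iff.1 h.valid.1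
    have := P.kSection_sub_mem y 1 m
    rwa [one_mul, P.kSection_of_right (v := v) h.right, h.left, ← P.kAug_nil v] at this

theorem exact_kTerm_zero {z : P.KFree M} (hz : z ∈ P.kTerm M 0) (h : P.kAug M z = 0) :
    ∃ y ∈ P.kTerm M 1, P.kDiff M 0 y = z := by
  have := P.sub_kSection_kAug_mem hz
  rwa [h, tmul_zero, map_zero, sub_zero] at this

/-- A left inverse of the first differential modulo the image of the second one. -/
theorem exists_left_inverse_kDiff {C : Type} [AddCommGroup C] [Module k C]
    (π : P.KFree M →ₗ[k] C) (hπ : ∀ z ∈ P.kTerm M 2, π (P.kDiff M 1 z) = 0) :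
    ∃ H : P.KFree M →ₗ[k] C, ∀ z ∈ P.kTerm M 1, H (P.kDiff M 0 z) = π z := by
  let q (a : Q.Arr) : R →ₗ[k] M →ₗ[k] C := LinearMap.mk₂ k
    (fun u m => π (P.kgen (Q.src a) [a] (u * P.e (Q.src a)) (P.e (Q.tgt a) • m)))
    (fun u u' m => by rw [add_mul, kgen_add_left, map_add])
    (fun c u m => by rw [smul_mul_assoc, kgen, ← smul_tmul', map_smul, kgen])
    (fun u m m' => by rw [smul_add, kgen, Finsupp.single_add, tmul_add, map_add, kgen, kgen])
    (fun c u m => by rw [smul_comm, kgen, ← Finsupp.smul_single, tmul_smul, map_smul, kgen])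
  have hq : ∀ a u m, q a u m =
    π (P.kgen (Q.src a) [a] (u * P.e (Q.src a)) (P.e (Q.tgt a) • m)) := fun _ _ _ => rfl
  obtain ⟨H, hH⟩ := P.exists_integral q
    (fun a u => LinearMap.ext fun m => by rw [hq, hq, mul_assoc, P.rels.idem])
    (fun a u m => by rw [hq, hq, ← mul_smul, P.rels.idem])
    (fun a b u m hab => by
      have hmem : P.KNormal 2 (Q.src a) [a, b] (u * P.e (Q.src a)) (P.e (Q.tgt b) • m) := by
        refine ⟨⟨rfl, by simp, by simpa using hab⟩, ?_, ?_⟩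
        · rw [mul_assoc, P.rels.idem]
        · rw [← mul_smul]
          exact congrArg (· • m) (P.rels.idem _)
      have := hπ _ hmem.mem
      have hd := P.dLast_concat (Q.src a) [a] b (u * P.e (Q.src a)) (P.e (Q.tgt b) • m)
      rw [List.singleton_append] at hd
      simp only [kDiff, LinearMap.add_apply, LinearMap.smul_apply, dHead_cons, hd, map_add] at this
      rw [hq, hq, P.rel_comp a b hab, ← mul_smul, P.rels.src_mul, mul_assoc,
        ← P.rel_comp a b hab, P.rels.mul_tgt, add_comm]
      simpa [mul_assoc, P.rels.src_mul, ← mul_smul, P.rels.mul_tgt] using this)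
  let J : ((Q.V × List Q.Arr) →₀ M) →ₗ[k] M := Finsupp.lsum ℕ fun i =>
    if i.2 = [] then LinearMap.id else 0
  refine ⟨TensorProduct.lift (LinearMap.compl₂ H J), fun z hz => ?_⟩
  have hgen : ∀ v y m, TensorProduct.lift (LinearMap.compl₂ H J) (P.kgen v [] y m) = H y m := by
    intro v y m
    simp [kgen, J]
  refine P.kTerm_induction (p := fun z => TensorProduct.lift (LinearMap.compl₂ H J)
    (P.kDiff M 0 z) = π z) (by simp) ?_ ?_ hz
  · intro z w hz hw
    simp only [map_add, hz, hw]
  · intro v l y m h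
    obtain ⟨a, rfl⟩ := List.length_eq_one_iff.1 h.valid.1
    have hv : Q.src a = v := by simpa using h.valid.2.1
    have hm : P.e (Q.tgt a) • m = m := h.right
    rw [kDiff_single, map_sub, hgen, hgen, hH, add_sub_cancel_left, hq, hv, h.left, hm]

theorem exact_kTerm_one {z : P.KFree M} (hz : z ∈ P.kTerm M 1) (h : P.kDiff M 0 z = 0) :
    ∃ y ∈ P.kTerm M 2, P.kDiff M 1 y = z := by
  obtain ⟨H, hH⟩ := P.exists_left_inverse_kDiff
    (((P.kTerm M 2).map (P.kDiff M 1)).mkQ.restrictScalars k) (fun z hz => by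
      rw [LinearMap.restrictScalars_apply, Submodule.mkQ_apply, Submodule.Quotient.mk_eq_zero]
      exact ⟨z, hz, rfl⟩)
  have := hH z hz
  rw [h, map_zero, eq_comm, LinearMap.restrictScalars_apply, Submodule.mkQ_apply,
    Submodule.Quotient.mk_eq_zero] at this
  exact this

open scoped Classical in
/-- The extension of words by an arrow on the left. -/
def wordCons (b : Q.Arr) : ((Q.V × List Q.Arr) →₀ M) →ₗ[k] ((Q.V × List Q.Arr) →₀ M) :=
  Finsupp.lsum ℕ fun i => if (∃ a ∈ i.2.head?, rel b a) then
    Finsupp.lsingle (Q.src b, b :: i.2) else 0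

/-- The Koszul complex is contractible over `k` in degrees at least two. -/
theorem exists_homotopy : ∃ H : P.KFree M →ₗ[k] P.KFree M, ∀ n, ∀ z ∈ P.kTerm M (n + 2),
    H z ∈ P.kTerm M (n + 3) ∧ P.kDiff M (n + 2) (H z) + H (P.kDiff M (n + 1) z) = z := by
  classical
  obtain ⟨δ, hδe, hδx⟩ := P.exists_fox
  let H : P.KFree M →ₗ[k] P.KFree M :=
    ∑ b, TensorProduct.map (δ b) (wordCons (rel := rel) (k := k) (M := M) b)
  have hH : ∀ v a l y m, H (P.kgen v (a :: l) y m) =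
      ∑ b, if rel b a then P.kgen (Q.src b) (b :: a :: l) (δ b y) m else 0 := by
    intro v a l y m
    simp only [H, kgen, LinearMap.sum_apply, TensorProduct.map_tmul]
    refine Finset.sum_congr rfl fun b _ => ?_
    by_cases h : rel b a <;> simp [wordCons, h]
  refine ⟨H, fun n z hz => P.kTerm_induction (p := fun z => H z ∈ P.kTerm M (n + 3) ∧
    P.kDiff M (n + 2) (H z) + H (P.kDiff M (n + 1) z) = z) (by simp) ?_ ?_ hz⟩
  · rintro z w ⟨hz, hz'⟩ ⟨hw, hw'⟩
    refine ⟨by rw [map_add]; exact add_mem hz hw, ?_⟩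
    simp only [map_add]
    rw [add_add_add_comm, hz', hw']
  · intro v l y m h
    match l with
    | [] => exact absurd h.valid.1 (by simp)
    | [a] => exact absurd h.valid.1 (by simp)
    | a :: c :: l =>
      have hac : rel a c := (List.isChain_cons_cons.1 h.valid.2.2).1
      have hv : Q.src a = v := by simpa using h.valid.2.1
      obtain ⟨l', z, hl⟩ : ∃ l' z, c :: l = l' ++ [z] :=
        ⟨_, _, (List.dropLast_append_getLast (List.cons_ne_nil c l)).symm⟩
      have hLH : P.dHead M (H (P.kgen v (a :: c :: l) y m)) =
          P.kgen v (a :: c :: l) (∑ b, if rel b a then δ b y * P.x b else 0) m := by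
        rw [hH, map_sum, kgen_sum_left]
        refine Finset.sum_congr rfl fun b _ => ?_
        split_ifs with hb
        · rw [dHead_cons, P.rel_comp b a hb, hv]
        · rw [map_zero, kgen_zero_left]
      have hHL : H (P.dHead M (P.kgen v (a :: c :: l) y m)) =
          P.kgen v (a :: c :: l) (y - ∑ b, if rel b a then δ b y * P.x b else 0) m := by
        rw [dHead_cons, hH, Finset.sum_eq_single a, if_pos hac, hδx, if_pos rfl, hv, h.left]
        · intro b _ hb
          rw [hδx, if_neg hb, kgen_zero_left, ite_self]
        · simp
      have hDH : P.dLast M (H (P.kgen v (a :: c :: l) y m)) =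
          H (P.dLast M (P.kgen v (a :: c :: l) y m)) := by
        rw [hH, hl, ← List.cons_append, dLast_concat, hH, map_sum]
        refine Finset.sum_congr rfl fun b _ => ?_
        split_ifs with hb
        · rw [← List.cons_append, dLast_concat]
        · rw [map_zero]
      constructor
      · rw [hH]
        refine sum_mem fun b _ => ?_
        split_ifs with hb
        · refine KNormal.mem ⟨⟨by simpa using h.valid.1, by simp, ?_⟩, hδe b y, ?_⟩
          · exact List.isChain_cons_cons.2 ⟨hb, h.valid.2.2⟩
          · have := h.right
            rw [wTgtD_cons] at this
            rwa [wTgtD_cons, wTgtD_cons]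
        · exact zero_mem _
      · simp only [kDiff, LinearMap.add_apply, LinearMap.smul_apply, map_add, map_zsmul, hLH, hHL,
          hDH, kgen_sub_left, pow_succ]
        module

theorem exact_kTerm_add_two {n : ℕ} {z : P.KFree M} (hz : z ∈ P.kTerm M (n + 2))
    (h : P.kDiff M (n + 1) z = 0) : ∃ y ∈ P.kTerm M (n + 3), P.kDiff M (n + 2) y = z := by
  obtain ⟨H, hH⟩ := P.exists_homotopy (M := M)
  obtain ⟨h1, h2⟩ := hH n z hz
  refine ⟨_, h1, ?_⟩
  rwa [h, map_zero, add_zero] at h2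

end Presentation

end Exactness

section GlobalDimension

open TensorProduct

namespace Presentation

set_option linter.unusedSectionVars false

variable {k : Type} [Field k] {Q : Quiv} {rel : Q.Arr → Q.Arr → Prop}
  {R : Type} [Ring R] [Algebra k R]
  (M : Type) [AddCommGroup M] [Module k M] [Module R M] [IsScalarTower k R M]

/-- The differential of the Koszul resolution. -/
def kMap (P : Presentation k Q rel R) (n : ℕ) : P.kTerm M (n + 1) →ₗ[R] P.kTerm M n :=
  (P.kDiff M n).restrict fun _ hz => P.kDiff_mem hz

/-- The Koszul resolution of a module. -/
def koszulResolution (P : Presentation k Q rel R) : ProjectiveResolution (ModuleCat.of R M) :=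
  resolutionOfExact (fun n => ModuleCat.of R (P.kTerm M n))
    (fun n => ModuleCat.ofHom (P.kMap M n))
    (ModuleCat.ofHom ((P.kAug M).domRestrict (P.kTerm M 0)))
    (fun n => by
      have := P.projective_kTerm M n
      exact (IsProjective.iff_projective _).1 this)
    (fun n => by
      refine ModuleCat.hom_ext (LinearMap.ext fun z => Subtype.ext ?_)
      exact P.kDiff_kDiff z.2)
    (by
      ext z
      exact P.kAug_kDiff z.2)
    (fun m => ⟨⟨P.kSection M (1 ⊗ₜ m), P.kSection_mem _⟩,
      (P.kAug_kSection 1 m).trans (one_smul R m)⟩)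
    (fun z hz => by
      obtain ⟨y, hy, h⟩ := P.exact_kTerm_zero z.2 hz
      exact ⟨⟨y, hy⟩, Subtype.ext h⟩)
    (fun n z hz => by
      have hz' : P.kDiff M n z.1 = 0 := congrArg Subtype.val hz
      cases n with
      | zero =>
        obtain ⟨y, hy, h⟩ := P.exact_kTerm_one z.2 hz'
        exact ⟨⟨y, hy⟩, Subtype.ext h⟩
      | succ n =>
        obtain ⟨y, hy, h⟩ := P.exact_kTerm_add_two z.2 hz'
        exact ⟨⟨y, hy⟩, Subtype.ext h⟩)

theorem kTerm_eq_bot (P : Presentation k Q rel R) {n : ℕ}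
    (h : ∀ l : List Q.Arr, l.IsChain rel → l.length ≠ n) :
    P.kTerm M n = ⊥ := by
  refine (Submodule.eq_bot_iff _).2 fun z hz => ?_
  refine P.kTerm_induction (p := fun z => z = 0) rfl ?_ ?_ hz
  · rintro z w rfl rfl
    exact add_zero 0
  · exact fun v l y m hl => absurd hl.valid.1 (h l hl.valid.2.2)

theorem not_extNZ_of_no_chain (P : Presentation k Q rel R) {n : ℕ}
    (h : ∀ l : List Q.Arr, l.IsChain rel → l.length ≠ n)
    (N N' : ModuleCat.{0} R) : ¬ extNZ n N N' := by
  let _ : Module k N := Module.compHom N (algebraMap k R)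
  have _ : IsScalarTower k R N := ⟨fun c r m => by
    rw [Algebra.smul_def, mul_smul]; rfl⟩
  refine not_extNZ_of_isZero (P.koszulResolution N) N' n ?_
  have : Subsingleton (P.kTerm N n) := by
    rw [P.kTerm_eq_bot N h]; infer_instance
  exact ModuleCat.isZero_of_subsingleton (ModuleCat.of R (P.kTerm N n))

theorem map_kMap_eq_zero (P : Presentation k Q rel R) {N : Type} [AddCommGroup N] [Module R N]
    (hM : ∀ a (m : M), P.x a • m = 0) (hN : ∀ a (m : N), P.x a • m = 0) {n : ℕ}
    (φ : P.kTerm M n →ₗ[R] N) (z : P.kTerm M (n + 1)) : φ (P.kMap M n z) = 0 := by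
  have key : ∃ hz : z.1 ∈ P.kTerm M (n + 1), φ ⟨P.kDiff M n z.1, P.kDiff_mem hz⟩ = 0 := by
    refine P.kTerm_induction (p := fun z => ∃ hz : z ∈ P.kTerm M (n + 1),
      φ ⟨P.kDiff M n z, P.kDiff_mem hz⟩ = 0) ⟨zero_mem _, ?_⟩ ?_ ?_ z.2
    · simp only [map_zero]
      exact map_zero φ
    · rintro z w ⟨hz, hz'⟩ ⟨hw, hw'⟩
      refine ⟨add_mem hz hw, ?_⟩
      simp only [map_add]
      exact (map_add φ ⟨P.kDiff M n z, P.kDiff_mem hz⟩ ⟨P.kDiff M n w, P.kDiff_mem hw⟩).trans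
        (by rw [hz', hw', add_zero])
    · intro v l y m h
      refine ⟨h.mem, ?_⟩
      have hlast : P.dLast M (P.kgen v l y m) = 0 := by
        cases l using List.reverseRecOn with
        | nil => simp
        | append_singleton l a => rw [dLast_concat, hM, kgen_zero_right]
      cases l with
      | nil => exact absurd h.valid.1 (by simp)
      | cons a l =>
        have hn : P.KNormal n (Q.tgt a) l (P.e (Q.tgt a)) m :=
          ⟨h.tail.valid, P.rels.idem _, h.tail.right⟩
        have : (⟨P.kDiff M n (P.kgen v (a :: l) y m), P.kDiff_mem h.mem⟩ : P.kTerm M n) =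
            (y * P.x a) • ⟨_, hn.mem⟩ := by
          refine Subtype.ext ?_
          simp only [kDiff, LinearMap.add_apply, LinearMap.smul_apply, hlast, smul_zero, add_zero,
            dHead_cons, Submodule.coe_smul]
          rw [kgen, kgen, smul_tmul', smul_eq_mul, mul_assoc, P.rels.mul_tgt]
        rw [this, map_smul, mul_smul, hN, smul_zero]
  exact key.2

theorem exists_semisimple_hom (P : Presentation k Q rel R) : ∃ f : R →ₐ[k] (Q.V → k),
    (∀ v, f (P.e v) = Pi.single v 1) ∧ ∀ a, f (P.x a) = 0 := by
  refine P.lift (Q.V → k) (fun v => Pi.single v 1) 0 ⟨?_, ?_, ?_, ?_, ?_, ?_⟩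
  · intro v
    rw [← Pi.single_mul, one_mul]
  · intro v w h
    ext u
    rcases eq_or_ne u v with rfl | hu
    · simp [h]
    · simp [hu]
  · exact Finset.univ_sum_single (1 : Q.V → k)
  · simp
  · simp
  · simp

theorem exists_extNZ_of_chain (P : Presentation k Q rel R) {l : List Q.Arr} (h : l.IsChain rel) :
    ∃ N N' : ModuleCat.{0} R, extNZ l.length N N' := by
  classical
  obtain ⟨f, hfe, hfx⟩ := P.exists_semisimple_hom
  let _ : Module R (Q.V → k) := Module.compHom _ f.toRingHom
  have hsmul : ∀ (r : R) (m : Q.V → k), r • m = f r * m := fun _ _ => rfl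
  have _ : IsScalarTower k R (Q.V → k) := ⟨fun c r m => by
    rw [hsmul, hsmul, map_smul, smul_mul_assoc]⟩
  obtain ⟨v, hv⟩ : ∃ v, P.KValid l.length (v, l) := by
    cases l with
    | nil => exact ⟨Classical.arbitrary _, rfl, by simp, h⟩
    | cons a l => exact ⟨Q.src a, rfl, by simp, h⟩
  have hx : ∀ a (m : Q.V → k), P.x a • m = 0 := fun a m => by rw [hsmul, hfx, zero_mul]
  let ψ : P.KFree (Q.V → k) →ₗ[R] (Q.V → k) := P.kExtend fun i => if i = (v, l) then
    LinearMap.toSpanSingleton k _ (Pi.single v 1) ∘ₗ LinearMap.proj (wTgtD l v) else 0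
  let φ : (P.koszulResolution (Q.V → k)).complex.X l.length ⟶ ModuleCat.of R (Q.V → k) :=
    ModuleCat.ofHom (ψ.domRestrict (P.kTerm (Q.V → k) l.length))
  refine ⟨ModuleCat.of R (Q.V → k), ModuleCat.of R (Q.V → k),
    extNZ_of_minimal (P.koszulResolution (Q.V → k)) _ _ (fun m n φ => ?_) φ fun hφ => ?_⟩
  · by_cases hmn : n + 1 = m
    · subst hmn
      have : (P.koszulResolution (Q.V → k)).complex.d (n + 1) n =
          ModuleCat.ofHom (P.kMap (Q.V → k) n) :=
        ChainComplex.of_d (fun n => ModuleCat.of R (P.kTerm (Q.V → k) n))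
          (fun n => ModuleCat.ofHom (P.kMap (Q.V → k) n)) n
      rw [this]
      refine ModuleCat.hom_ext (LinearMap.ext fun z => ?_)
      exact P.map_kMap_eq_zero (Q.V → k) hx hx φ.hom z
    · rw [(P.koszulResolution (Q.V → k)).complex.shape _ _ hmn, Limits.zero_comp]
  · have hn : P.KNormal l.length v l (P.e v) (Pi.single (wTgtD l v) (1 : k)) :=
      ⟨hv, P.rels.idem v, by rw [hsmul, hfe, ← Pi.single_mul, one_mul]⟩
    have h0 : ψ (P.kgen v l (P.e v) (Pi.single (wTgtD l v) (1 : k))) = 0 :=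
      LinearMap.congr_fun (congrArg ModuleCat.Hom.hom hφ)
        (⟨_, hn.mem⟩ : P.kTerm (Q.V → k) l.length)
    have h1 := congrFun h0 v
    simp [ψ, kExtend_kgen, hsmul, hfe] at h1

theorem exists_extNZ_iff (P : Presentation k Q rel R) (n : ℕ) :
    (∃ N N' : ModuleCat.{0} R, extNZ n N N') ↔
    ∃ l : List Q.Arr, l.IsChain rel ∧ l.length = n := by
  constructor
  · rintro ⟨N, N', h⟩
    by_contra! hn
    exact P.not_extNZ_of_no_chain hn N N' h
  · rintro ⟨l, hl, rfl⟩
    exact P.exists_extNZ_of_chain hl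

end Presentation

end GlobalDimension

section OppositeAlgebra

/-- The opposite quiver. -/
def Quiv.op (Q : Quiv) : Quiv where
  V := Q.V
  Arr := Q.Arr
  src := Q.tgt
  tgt := Q.src
  connected := by
    have : SimpleGraph.fromRel (fun v w => ∃ a, Q.tgt a = v ∧ Q.src a = w) =
        SimpleGraph.fromRel (fun v w => ∃ a, Q.src a = v ∧ Q.tgt a = w) := by
      ext v w
      simp only [SimpleGraph.fromRel_adj, and_comm, or_comm]
    rw [this]
    exact Q.connected

variable {k : Type} [Field k] {Q : Quiv} {rel : Q.Arr → Q.Arr → Prop}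

/-- The opposite of a quadratic presentation. -/
def Presentation.op {R : Type} [Ring R] [Algebra k R] (P : Presentation k Q rel R) :
    Presentation k Q.op (fun a b : Q.Arr => rel b a) Rᵐᵒᵖ where
  e v := MulOpposite.op (P.e v)
  x a := MulOpposite.op (P.x a)
  rels :=
    { idem := fun v => congrArg MulOpposite.op (P.rels.idem v)
      orth := fun v w h => congrArg MulOpposite.op (P.rels.orth w v h.symm)
      unit := by
        refine (Finset.op_sum (Finset.univ : Finset Q.V) P.e).symm.trans ?_
        rw [P.rels.unit, MulOpposite.op_one]
      src_mul := fun a => congrArg MulOpposite.op (P.rels.mul_tgt a)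
      mul_tgt := fun a => congrArg MulOpposite.op (P.rels.src_mul a)
      rel_zero := fun a b h => congrArg MulOpposite.op (P.rels.rel_zero b a h) }
  rel_comp a b h := (P.rel_comp b a h).symm
  lift B _ _ E X h := by
    obtain ⟨f, hE, hX⟩ := P.lift Bᵐᵒᵖ (fun v => MulOpposite.op (E v))
      (fun a => MulOpposite.op (X a))
      { idem := fun v => congrArg MulOpposite.op (h.idem v)
        orth := fun v w hvw => congrArg MulOpposite.op (h.orth w v hvw.symm)
        unit := by
          refine (Finset.op_sum (Finset.univ : Finset Q.V) E).symm.trans ?_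
          exact congrArg MulOpposite.op h.unit
        src_mul := fun a => congrArg MulOpposite.op (h.mul_tgt a)
        mul_tgt := fun a => congrArg MulOpposite.op (h.src_mul a)
        rel_zero := fun a b hab => congrArg MulOpposite.op (h.rel_zero b a hab) }
    exact ⟨AlgHom.opComm f, fun v => congrArg MulOpposite.unop (hE v),
      fun a => congrArg MulOpposite.unop (hX a)⟩
  gen S he hx := by
    have := P.gen S.unop he hx
    rw [← Subalgebra.op_unop S, this, Subalgebra.op_top]

/-- The tautological presentation of `kQ/I`. -/
def gaPresentation (k : Type) [Field k] (Q : Quiv) (rel : Q.Arr → Q.Arr → Prop)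
    (hcomp : ∀ a b, rel a b → Q.tgt a = Q.src b) : Presentation k Q rel (GA k Q rel) where
  e := vtx k Q rel
  x := arr k Q rel
  rels :=
    { idem := fun v => (map_mul _ _ _).symm.trans (RingQuot.mkAlgHom_rel k (.idem v))
      orth := fun v w h => (map_mul _ _ _).symm.trans
        ((RingQuot.mkAlgHom_rel k (.orth v w h)).trans (map_zero _))
      unit := (map_sum _ _ _).symm.trans ((RingQuot.mkAlgHom_rel k .unit).trans (map_one _))
      src_mul := fun a => (map_mul _ _ _).symm.trans (RingQuot.mkAlgHom_rel k (.src_mul a))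
      mul_tgt := fun a => (map_mul _ _ _).symm.trans (RingQuot.mkAlgHom_rel k (.mul_tgt a))
      rel_zero := fun a b h => (map_mul _ _ _).symm.trans
        ((RingQuot.mkAlgHom_rel k (.rel_zero a b h)).trans (map_zero _)) }
  rel_comp := hcomp
  lift B _ _ E X h := by
    refine ⟨RingQuot.liftAlgHom k ⟨FreeAlgebra.lift k (Sum.elim E X), ?_⟩, fun v => ?_,
      fun a => ?_⟩
    · intro x y hxy
      cases hxy with
      | idem v => simpa using h.idem v
      | orth v w hvw => simpa using h.orth v w hvw
      | unit => simpa using h.unit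
      | src_mul a => simpa using h.src_mul a
      | mul_tgt a => simpa using h.mul_tgt a
      | src_zero v a hv =>
        simp only [map_mul, FreeAlgebra.lift_ι_apply, Sum.elim_inl, Sum.elim_inr, map_zero]
        rw [← h.src_mul a, ← mul_assoc, h.orth v _ hv, zero_mul]
      | tgt_zero v a hv =>
        simp only [map_mul, FreeAlgebra.lift_ι_apply, Sum.elim_inl, Sum.elim_inr, map_zero]
        rw [← h.mul_tgt a, mul_assoc, h.orth _ v hv.symm, mul_zero]
      | rel_zero a b hab => simpa using h.rel_zero a b hab
    · simp [vtx]
    · simp [arr]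
  gen S he hx := by
    have hS : S.comap (RingQuot.mkAlgHom k (GARel k Q rel)) = ⊤ := by
      rw [eq_top_iff, ← FreeAlgebra.adjoin_range_ι, Algebra.adjoin_le_iff]
      rintro _ ⟨v | a, rfl⟩
      · exact he v
      · exact hx a
    refine Algebra.eq_top_iff.2 fun r => ?_
    obtain ⟨f, rfl⟩ := RingQuot.mkAlgHom_surjective k (GARel k Q rel) r
    have : f ∈ S.comap (RingQuot.mkAlgHom k (GARel k Q rel)) := hS ▸ Algebra.mem_top
    exact this

theorem lGlDim_eq (hcomp : ∀ a b, rel a b → Q.tgt a = Q.src b) :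
    lGlDim k Q rel = sSup {n : ℕ∞ | ∃ l : List Q.Arr, l.IsChain rel ∧ n = l.length} := by
  rw [lGlDim]
  congr 1
  ext n
  constructor
  · rintro ⟨i, M, N, rfl, h⟩
    obtain ⟨l, hl, rfl⟩ := ((gaPresentation k Q rel hcomp).exists_extNZ_iff i).1 ⟨M, N, h⟩
    exact ⟨l, hl, rfl⟩
  · rintro ⟨l, hl, rfl⟩
    obtain ⟨M, N, h⟩ := ((gaPresentation k Q rel hcomp).exists_extNZ_iff _).2 ⟨l, hl, rfl⟩
    exact ⟨_, M, N, rfl, h⟩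

theorem rGlDim_eq (hcomp : ∀ a b, rel a b → Q.tgt a = Q.src b) :
    rGlDim k Q rel = sSup {n : ℕ∞ | ∃ l : List Q.Arr, l.IsChain rel ∧ n = l.length} := by
  rw [rGlDim]
  congr 1
  ext n
  constructor
  · rintro ⟨i, M, N, rfl, h⟩
    obtain ⟨l, hl, rfl⟩ := ((gaPresentation k Q rel hcomp).op.exists_extNZ_iff i).1 ⟨M, N, h⟩
    exact ⟨l.reverse, List.isChain_reverse.2 hl, congrArg Nat.cast List.length_reverse.symm⟩
  · rintro ⟨l, hl, rfl⟩
    obtain ⟨M, N, h⟩ := ((gaPresentation k Q rel hcomp).op.exists_extNZ_iff l.length).2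
      ⟨l.reverse, List.isChain_reverse.2 hl, List.length_reverse⟩
    exact ⟨_, M, N, rfl, h⟩

end OppositeAlgebra

section MaximalPaths

variable {Q : Quiv} {rel : Q.Arr → Q.Arr → Prop}

theorem allowedWord_dualRel_iff (hcomp : ∀ a b, rel a b → Q.tgt a = Q.src b)
    (l : List Q.Arr) : AllowedWord (dualRel rel) l ↔ l.IsChain rel := by
  have : (fun a b => Q.tgt a = Q.src b ∧ ¬ dualRel rel a b) = rel := by
    ext a b
    have := hcomp a b
    simp only [dualRel]
    tauto
  change List.IsChain (fun a b => Q.tgt a = Q.src b ∧ ¬ dualRel rel a b) l ↔ _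
  rw [this]

theorem isChain_flatten_replicate {α : Type} {r : α → α → Prop} {c : List α}
    (h : (c ++ c).IsChain r) (n : ℕ) : (List.replicate n c).flatten.IsChain r := by
  rcases eq_or_ne c [] with rfl | hc
  · simp
  have h' := List.isChain_append.1 h
  refine (List.isChain_flatten (by simp [hc.symm])).2 ⟨?_, ?_⟩
  · intro l hl
    rw [List.eq_of_mem_replicate hl]
    exact h'.1
  · exact List.isChain_replicate_of_rel n h'.2.2

/-- A shortest closed chain is a primitive cycle. -/
theorem exists_primCycleSq (hcomp : ∀ a b, rel a b → Q.tgt a = Q.src b) {c : List Q.Arr}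
    (hc : c ≠ []) (h : (c ++ c).IsChain rel) : ∃ c', PrimCycleSq (dualRel rel) c' := by
  induction hn : c.length using Nat.strong_induction_on generalizing c with
  | _ n ih =>
    subst hn
    by_cases hp : PrimitiveWord c
    · refine ⟨c, hc, (allowedWord_dualRel_iff hcomp _).2 h, ?_, hp⟩
      have := (List.isChain_append.1 h).2.2
      rw [wTgt?, wSrc?, List.getLast?_eq_some_getLast hc, List.head?_eq_some_head hc,
        Option.map_some, Option.map_some]
      exact congrArg some (hcomp _ _ (this _ (List.getLast?_eq_some_getLast hc) _
        (List.head?_eq_some_head hc)))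
    · simp only [PrimitiveWord, not_forall, not_not] at hp
      obtain ⟨l, n, hn, rfl⟩ := hp
      obtain ⟨n, rfl⟩ := Nat.exists_eq_add_of_le' hn
      have hl : l ≠ [] := by
        rintro rfl
        simp at hc
      have hpos := List.length_pos_iff.2 hl
      refine ih l.length ?_ hl ?_ rfl
      · simp only [List.replicate_succ, List.flatten_cons, List.length_append]
        omega
      · have h1 := h.left_of_append
        simp only [List.replicate_succ, List.flatten_cons] at h1
        rw [← List.append_assoc] at h1
        exact h1.left_of_append

theorem nodup_of_isChain (hcomp : ∀ a b, rel a b → Q.tgt a = Q.src b)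
    (hno : ∀ c, ¬ PrimCycleSq (dualRel rel) c) {l : List Q.Arr} (h : l.IsChain rel) :
    l.Nodup := by
  by_contra hl
  obtain ⟨a, ha⟩ := List.exists_duplicate_iff_not_nodup.2 hl
  obtain ⟨s, t, rfl, hs, ht⟩ : ∃ s t, l = s ++ t ∧ a ∈ s ∧ a ∈ t := by
    clear h hl
    induction ha with
    | cons_mem hm => exact ⟨[a], _, rfl, by simp, hm⟩
    | cons_duplicate _ ih =>
      obtain ⟨s, t, rfl, hs, ht⟩ := ih
      exact ⟨_ :: s, t, rfl, List.mem_cons_of_mem _ hs, ht⟩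
  obtain ⟨s₁, s₂, rfl⟩ := List.append_of_mem hs
  obtain ⟨t₁, t₂, rfl⟩ := List.append_of_mem ht
  have h1 : ((a :: s₂ ++ t₁) ++ (a :: t₂)).IsChain rel := by
    have : ((s₁ ++ a :: s₂) ++ (t₁ ++ a :: t₂)) = s₁ ++ ((a :: s₂ ++ t₁) ++ (a :: t₂)) := by
      simp
    rw [this] at h
    exact h.right_of_append
  obtain ⟨c, hc⟩ := exists_primCycleSq hcomp (c := a :: s₂ ++ t₁) (by simp) (by
    have h2 := List.isChain_append.1 h1
    refine List.isChain_append.2 ⟨h2.1, h2.1, fun x hx y hy => ?_⟩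
    exact h2.2.2 x hx y (by simpa using hy))
  exact hno c hc

theorem exists_longest_finiteMaxWord (hcomp : ∀ a b, rel a b → Q.tgt a = Q.src b)
    (hno : ∀ c, ¬ PrimCycleSq (dualRel rel) c) :
    ∃ L, FiniteMaxWord (dualRel rel) L ∧ ∀ l : List Q.Arr, l.IsChain rel → l.length ≤ L.length := by
  let S : Set ℕ := {n | ∃ l : List Q.Arr, l.IsChain rel ∧ l.length = n}
  have hbdd : BddAbove S := by
    refine ⟨Fintype.card Q.Arr, ?_⟩
    rintro _ ⟨l, hl, rfl⟩
    exact (nodup_of_isChain hcomp hno hl).length_le_card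
  obtain ⟨L, hL, hlen⟩ := Nat.sSup_mem (s := S) ⟨0, [], List.isChain_nil, rfl⟩ hbdd
  have hmax : ∀ l : List Q.Arr, l.IsChain rel → l.length ≤ L.length := fun l hl =>
    hlen ▸ le_csSup hbdd ⟨l, hl, rfl⟩
  have hne : L ≠ [] := by
    rintro rfl
    simpa using hmax [Classical.arbitrary Q.Arr] (List.isChain_singleton _)
  have hL' := (allowedWord_dualRel_iff hcomp L).2 hL
  refine ⟨L, ⟨⟨hne, hL', fun a ha => ?_⟩, ⟨hne, hL', fun a ha => ?_⟩⟩, hmax⟩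
  · simpa using hmax _ ((allowedWord_dualRel_iff hcomp _).1 ha)
  · simpa using hmax _ ((allowedWord_dualRel_iff hcomp _).1 ha)

theorem sSup_chain_eq (hcomp : ∀ a b, rel a b → Q.tgt a = Q.src b) :
    sSup {n : ℕ∞ | ∃ l : List Q.Arr, l.IsChain rel ∧ n = l.length} =
      sSup {x : ℕ∞ | ∃ a : Q.Arr,
        (∃ l : List Q.Arr, FiniteMaxWord (dualRel rel) l ∧ a ∈ l ∧ x = (l.length : ℕ∞)) ∨
        (x = ⊤ ∧ InfThrough (dualRel rel) a)} := by
  refine le_antisymm (sSup_le ?_) (sSup_le ?_)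
  · rintro _ ⟨l, hl, rfl⟩
    by_cases hno : ∀ c, ¬ PrimCycleSq (dualRel rel) c
    · obtain ⟨L, hL, hmax⟩ := exists_longest_finiteMaxWord hcomp hno
      obtain ⟨a, ha⟩ := List.exists_mem_of_ne_nil L hL.1.1
      exact (Nat.cast_le.2 (hmax l hl)).trans (le_sSup ⟨a, Or.inl ⟨L, hL, ha, rfl⟩⟩)
    · push Not at hno
      obtain ⟨c, hc⟩ := hno
      obtain ⟨a, ha⟩ := List.exists_mem_of_ne_nil c hc.1
      exact le_top.trans (le_sSup ⟨a, Or.inr ⟨rfl, c, hc, ha⟩⟩)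
  · rintro _ ⟨a, ⟨l, hl, -, rfl⟩ | ⟨rfl, c, hc, -⟩⟩
    · exact le_sSup ⟨l, (allowedWord_dualRel_iff hcomp l).1 hl.1.2.1, rfl⟩
    · refine (ENat.eq_top_iff_forall_ge.2 fun n => ?_).ge
      refine le_trans ?_ (le_sSup ⟨_, isChain_flatten_replicate
        ((allowedWord_dualRel_iff hcomp _).1 hc.2.1) n, rfl⟩)
      have := List.length_pos_iff.2 hc.1
      rw [Nat.cast_le, List.length_flatten, List.map_replicate, List.sum_replicate, smul_eq_mul]
      exact Nat.le_mul_of_pos_right n this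

end MaximalPaths

/-- **Theorem 4.4 (thm:gldim).** Let `A = kQ/I` be a (locally) gentle algebra.  Then the
left and right (graded) global dimensions of `A` agree and
`gldim A = max_{α ∈ Q₁} ℓ(γ#_α)`, the length of the longest maximal path of the Koszul
dual `A#` (an infinite maximal path counting as length `∞`). -/
theorem statement11 (k : Type) [Field k] [CharZero k] (Q : Quiv)
    (rel : Q.Arr → Q.Arr → Prop) (hgentle : IsGentleRel Q rel) :
    lGlDim k Q rel = rGlDim k Q rel ∧
    rGlDim k Q rel =
      sSup {x : ℕ∞ | ∃ a : Q.Arr,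
        (∃ l : List Q.Arr, FiniteMaxWord (dualRel rel) l ∧ a ∈ l ∧ x = (l.length : ℕ∞)) ∨
        (x = ⊤ ∧ InfThrough (dualRel rel) a)} := by
  have hcomp := hgentle.rel_comp
  rw [rGlDim_eq hcomp, lGlDim_eq hcomp]
  exact ⟨rfl, sSup_chain_eq hcomp⟩

end LocGentle
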